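/- arXiv:2206.09419 — 3 statements merged into one kernel-verified Lean document; each statement's English description precedes it below -/
import Mathlib

section
/- Let ζ : [t₀,T] → ℝⁿ be differentiable with ζ'(s) = −A(s)·ζ(s) for all s ∈ [t₀,T], and set η(s) = π(s)·ζ(s). Then η(T) = 0 and −η'(s) + A(s)ᵀ·η(s) = M(s)·ζ(s) for all s ∈ [t₀,T]. -/
open Matrix Set

/-- Product rule for a matrix with differentiable entries acting on a differentiable vector. -/
theorem Matrix.hasDerivAt_mulVec {m n : Type*} [Fintype m] [Fintype n]
    {P : ℝ → Matrix m n ℝ} {P' : Matrix m n ℝ} {v : ℝ → n → ℝ} {v' : n → ℝ} {t : ℝ}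
    (hP : ∀ i j, HasDerivAt (fun τ => P τ i j) (P' i j) t) (hv : HasDerivAt v v' t) :
    HasDerivAt (fun τ => P τ *ᵥ v τ) (P' *ᵥ v t + P t *ᵥ v') t := by
  rw [hasDerivAt_pi] at hv ⊢
  intro i
  simp only [mulVec, dotProduct, Pi.add_apply, ← Finset.sum_add_distrib]
  exact HasDerivAt.fun_sum fun j _ => (hP i j).mul (hv j)

/-- If `ζ' = −A ζ` and `η = π ζ` where `π` solves the
Lyapunov-type equation `π' = πA + Aᵀπ − M` with `π(T) = 0`, then `η(T) = 0` and
`−η' + Aᵀ η = M ζ`. -/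
theorem stmt_5
    {n : ℕ} {t₀ T : ℝ} (htT : t₀ < T)
    (A M : ℝ → Matrix (Fin n) (Fin n) ℝ)
    (hA : ContinuousOn A (Icc t₀ T)) (hM : ContinuousOn M (Icc t₀ T))
    (hMpsd : ∀ t ∈ Icc t₀ T, (M t).PosSemidef)
    (π : ℝ → Matrix (Fin n) (Fin n) ℝ)
    (hπ : ∀ t ∈ Icc t₀ T, ∀ i j, HasDerivAt (fun τ => π τ i j)
      ((π t * A t + (A t)ᵀ * π t - M t) i j) t)
    (hπT : π T = 0)
    (ζ : ℝ → Fin n → ℝ)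
    (hζ : ∀ s ∈ Icc t₀ T, HasDerivAt ζ (-(A s *ᵥ ζ s)) s)
    (η : ℝ → Fin n → ℝ)
    (hη : ∀ s, η s = π s *ᵥ ζ s) :
    η T = 0 ∧
    ∀ s ∈ Icc t₀ T,
      HasDerivAt η ((A s)ᵀ *ᵥ η s - M s *ᵥ ζ s) s := by
  refine ⟨by rw [hη, hπT, zero_mulVec], fun s hs => ?_⟩
  obtain rfl : η = fun τ => π τ *ᵥ ζ τ := funext hη
  convert hasDerivAt_mulVec (hπ s hs) (hζ s hs) using 1
  simp only [sub_mulVec, add_mulVec, mulVec_neg, mulVec_mulVec]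
  abel
end

section
/- Let A : [t₀,T] → Matrix (Fin n) (Fin n) ℝ and f : [t₀,T] → ℝⁿ be continuous, fix t ∈ [t₀,T] and z ∈ ℝⁿ. Let y : [t₀,T] → ℝⁿ be differentiable with y'(s) = −A(s)·y(s) + f(s) for all s, and let χ : [t₀,t] → ℝⁿ be differentiable with χ'(s) = A(s)ᵀ·χ(s) for all s ∈ [t₀,t] and χ(t) = z. Then ⟨y(t), z⟩ = ⟨y(t₀), χ(t₀)⟩ + ∫_{t₀}^t ⟨f(s), χ(s)⟩ ds. -/
open Matrix Set

/-- Product rule for the dot product of two differentiable curves. -/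
theorem hasDerivAt_dotProduct {ι : Type*} [Fintype ι] {u v : ℝ → ι → ℝ} {u' v' : ι → ℝ} {s : ℝ}
    (hu : HasDerivAt u u' s) (hv : HasDerivAt v v' s) :
    HasDerivAt (fun r => u r ⬝ᵥ v r) (u' ⬝ᵥ v s + u s ⬝ᵥ v') s := by
  simp only [dotProduct, ← Finset.sum_add_distrib]
  exact HasDerivAt.fun_sum fun i _ => (hasDerivAt_pi.1 hu i).mul (hasDerivAt_pi.1 hv i)

/-- Variation-of-constants duality: if `y' = −Ay + f` and the
adjoint trajectory `χ` satisfies `χ' = Aᵀχ` with `χ(t) = z`, then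
`⟨y(t), z⟩ = ⟨y(t₀), χ(t₀)⟩ + ∫_{t₀}^t ⟨f(s), χ(s)⟩ ds`. -/
theorem stmt_8
    {n : ℕ} {t₀ T : ℝ} (htT : t₀ < T)
    (A : ℝ → Matrix (Fin n) (Fin n) ℝ) (f : ℝ → Fin n → ℝ)
    (hA : ContinuousOn A (Icc t₀ T)) (hf : ContinuousOn f (Icc t₀ T))
    (t : ℝ) (ht : t ∈ Icc t₀ T) (z : Fin n → ℝ)
    (y : ℝ → Fin n → ℝ)
    (hy : ∀ s ∈ Icc t₀ T, HasDerivAt y (-(A s *ᵥ y s) + f s) s)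
    (χ : ℝ → Fin n → ℝ)
    (hχ : ∀ s ∈ Icc t₀ t, HasDerivAt χ ((A s)ᵀ *ᵥ χ s) s)
    (hχt : χ t = z) :
    (y t) ⬝ᵥ z = (y t₀) ⬝ᵥ χ t₀ + ∫ s in t₀..t, (f s) ⬝ᵥ χ s := by
  subst hχt
  have hsub : Icc t₀ t ⊆ Icc t₀ T := Icc_subset_Icc_right ht.2
  have hderiv : ∀ s ∈ uIcc t₀ t, HasDerivAt (fun r => y r ⬝ᵥ χ r) (f s ⬝ᵥ χ s) s := by
    intro s hs
    rw [uIcc_of_le ht.1] at hs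
    convert hasDerivAt_dotProduct (hy s (hsub hs)) (hχ s hs) using 1
    rw [add_dotProduct, neg_dotProduct, dotProduct_mulVec, vecMul_transpose]
    ring
  have hcont : ContinuousOn (fun s => f s ⬝ᵥ χ s) (uIcc t₀ t) := by
    rw [uIcc_of_le ht.1]
    have hχc : ContinuousOn χ (Icc t₀ t) := HasDerivAt.continuousOn hχ
    exact continuousOn_finsetSum _ fun i _ =>
      (continuousOn_pi.1 (hf.mono hsub) i).mul (continuousOn_pi.1 hχc i)
  rw [intervalIntegral.integral_eq_sub_of_hasDerivAt hderiv hcont.intervalIntegrable]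
  ring
end

section
/- Fix t ∈ (t₀,T] and z ∈ ℝⁿ. Set y_z(s) = K(s,t)·z, χ(s) = Φ_A(t,s)ᵀ·z, ρ(s) = Φ(t,s)ᵀ·z, and q(s) = P(s)·y_z(s) + 𝟙_{s<t}·(χ(s) − ρ(s)). Then q(T) = 0, J₀·y_z(t₀) = χ(t₀) − q(t₀), and for every s ∈ (t₀,t) ∪ (t,T): −q'(s) + A(s)ᵀ·q(s) = M(s)·y_z(s) and y_z'(s) + A(s)·y_z(s) + B(s)·N(s)⁻¹·B(s)ᵀ·q(s) = 𝟙_{s<t}·B(s)·N(s)⁻¹·B(s)ᵀ·χ(s). -/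
open MeasureTheory Matrix Set

/-- Product rule for matrix-valued curves with entrywise derivatives. -/
theorem hasDerivAt_matrix_mul {l m n : Type*} [Fintype m]
    {X : ℝ → Matrix l m ℝ} {Y : ℝ → Matrix m n ℝ} {X' : Matrix l m ℝ} {Y' : Matrix m n ℝ} {s : ℝ}
    (hX : ∀ i j, HasDerivAt (fun τ => X τ i j) (X' i j) s)
    (hY : ∀ i j, HasDerivAt (fun τ => Y τ i j) (Y' i j) s) (i : l) (j : n) :
    HasDerivAt (fun τ => (X τ * Y τ) i j) ((X' * Y s + X s * Y') i j) s := by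
  simp only [Matrix.add_apply, Matrix.mul_apply, ← Finset.sum_add_distrib]
  exact HasDerivAt.fun_sum fun k _ => (hX i k).mul (hY k j)

/-- Product rule for the matrix-vector product, with an entrywise derivative of the matrix. -/
theorem hasDerivAt_matrix_mulVec {l m : Type*} [Fintype l] [Fintype m]
    {X : ℝ → Matrix l m ℝ} {v : ℝ → m → ℝ} {X' : Matrix l m ℝ} {v' : m → ℝ} {s : ℝ}
    (hX : ∀ i j, HasDerivAt (fun τ => X τ i j) (X' i j) s) (hv : HasDerivAt v v' s) :
    HasDerivAt (fun τ => X τ *ᵥ v τ) (X' *ᵥ v s + X s *ᵥ v') s := by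
  rw [hasDerivAt_pi] at hv ⊢
  intro i
  simp only [Pi.add_apply, Matrix.mulVec, dotProduct, ← Finset.sum_add_distrib]
  exact HasDerivAt.fun_sum fun k _ => (hX i k).mul (hv k)

/-- A matrix-valued curve with vanishing entrywise derivative on an interval is constant there. -/
theorem matrix_eq_of_hasDerivAt_zero {l m : Type*} {a b : ℝ} {X : ℝ → Matrix l m ℝ}
    (hX : ∀ s ∈ Icc a b, ∀ i j, HasDerivAt (fun τ => X τ i j) 0 s)
    {s u : ℝ} (hs : s ∈ Icc a b) (hu : u ∈ Icc a b) : X s = X u := by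
  ext i j
  have h := constant_of_has_deriv_right_zero (f := fun τ => X τ i j) (a := a) (b := b)
    (fun x hx => (hX x hx i j).continuousAt.continuousWithinAt)
    (fun x hx => (hX x (Ico_subset_Icc_self hx) i j).hasDerivWithinAt)
  exact (h s hs).trans (h u hu).symm

theorem continuousOn_matrix_of_hasDerivAt {l m : Type*} {D : Set ℝ} {X X' : ℝ → Matrix l m ℝ}
    (hX : ∀ s ∈ D, ∀ i j, HasDerivAt (fun τ => X τ i j) (X' s i j) s) : ContinuousOn X D :=
  continuousOn_pi.2 fun i => continuousOn_pi.2 fun j s hs =>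
    (hX s hs i j).continuousAt.continuousWithinAt

theorem ContinuousOn.matrix_inv {n : Type*} [Fintype n] [DecidableEq n] {D : Set ℝ}
    {X : ℝ → Matrix n n ℝ} (hX : ContinuousOn X D) (hdet : ∀ s ∈ D, (X s).det ≠ 0) :
    ContinuousOn (fun s => (X s)⁻¹) D := by
  simp only [Matrix.inv_def, Ring.inverse_eq_inv']
  exact ((continuous_id.matrix_det.comp_continuousOn hX).inv₀ hdet).smul
    (continuous_id.matrix_adjugate.comp_continuousOn hX)

theorem ContinuousOn.matrix_mul_matrix {l m n : Type*} [Fintype m] {D : Set ℝ}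
    {X : ℝ → Matrix l m ℝ} {Y : ℝ → Matrix m n ℝ} (hX : ContinuousOn X D)
    (hY : ContinuousOn Y D) : ContinuousOn (fun s => X s * Y s) D :=
  (continuous_fst.matrix_mul continuous_snd).comp_continuousOn (hX.prodMk hY)

section EvolutionFamily

variable {n : Type*} [Fintype n] [DecidableEq n] {a b : ℝ} {F : ℝ → Matrix n n ℝ}
  {Φ : ℝ → ℝ → Matrix n n ℝ}

/-- The cocycle identity of an evolution family. -/
theorem evolutionFamily_mul (hΦ0 : ∀ s ∈ Icc a b, Φ s s = 1)
    (hΦt : ∀ s ∈ Icc a b, ∀ t ∈ Icc a b, ∀ i j,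
      HasDerivAt (fun τ => Φ τ s i j) ((-(F t * Φ t s)) i j) t)
    (hΦs : ∀ t ∈ Icc a b, ∀ s ∈ Icc a b, ∀ i j,
      HasDerivAt (fun σ => Φ t σ i j) ((Φ t s * F s) i j) s)
    {r s u : ℝ} (hr : r ∈ Icc a b) (hs : s ∈ Icc a b) (hu : u ∈ Icc a b) :
    Φ r s * Φ s u = Φ r u := by
  have h := matrix_eq_of_hasDerivAt_zero (X := fun σ => Φ r σ * Φ σ u) (a := a) (b := b)
    (fun σ hσ i j => by
      have := hasDerivAt_matrix_mul (hΦs r hr σ hσ) (hΦt u hu σ hσ) i j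
      simpa [Matrix.mul_assoc] using this) hs hu
  simpa [hΦ0 u hu] using h

/-- A solution of `D' = D F + Fᵀ D` vanishing at the right endpoint vanishes identically. -/
theorem lyapunov_eq_zero (hab : a ≤ b) (hΦ0 : ∀ s ∈ Icc a b, Φ s s = 1)
    (hΦt : ∀ s ∈ Icc a b, ∀ t ∈ Icc a b, ∀ i j,
      HasDerivAt (fun τ => Φ τ s i j) ((-(F t * Φ t s)) i j) t)
    {D : ℝ → Matrix n n ℝ}
    (hD : ∀ s ∈ Icc a b, ∀ i j,
      HasDerivAt (fun τ => D τ i j) ((D s * F s + (F s)ᵀ * D s) i j) s)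
    (hDb : D b = 0) {s : ℝ} (hs : s ∈ Icc a b) : D s = 0 := by
  have h := matrix_eq_of_hasDerivAt_zero (X := fun σ => (Φ σ s)ᵀ * (D σ * Φ σ s)) (a := a) (b := b)
    (fun σ hσ i j => by
      have hT : ∀ i j, HasDerivAt (fun τ => (Φ τ s)ᵀ i j) ((-(F σ * Φ σ s))ᵀ i j) σ :=
        fun i j => hΦt s hs σ hσ j i
      have := hasDerivAt_matrix_mul hT (hasDerivAt_matrix_mul (hD σ hσ) (hΦt s hs σ hσ)) i j
      refine this.congr_deriv (congrFun (congrFun (?_ : _ = (0 : Matrix n n ℝ)) i) j)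
      simp only [Matrix.transpose_neg, Matrix.transpose_mul, Matrix.neg_mul, Matrix.mul_neg,
        Matrix.mul_add, Matrix.add_mul, Matrix.mul_assoc]
      abel) hs (right_mem_Icc.2 hab)
  simpa [hΦ0 s hs, hDb] using h

/-- Variation of constants: the derivative of `s ↦ Φ(s,a) C + ∫_a^s Φ(s,τ) R(τ) dτ`, stated for
the upper limit replaced by `min s t`. -/
theorem hasDerivAt_variation_of_constants {m : Type*} [Fintype m]
    (hΦ0 : ∀ s ∈ Icc a b, Φ s s = 1)
    (hΦt : ∀ s ∈ Icc a b, ∀ t ∈ Icc a b, ∀ i j,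
      HasDerivAt (fun τ => Φ τ s i j) ((-(F t * Φ t s)) i j) t)
    (hΦs : ∀ t ∈ Icc a b, ∀ s ∈ Icc a b, ∀ i j,
      HasDerivAt (fun σ => Φ t σ i j) ((Φ t s * F s) i j) s)
    {R : ℝ → Matrix n m ℝ} (hR : ContinuousOn R (Icc a b)) (C : Matrix n m ℝ)
    {t : ℝ} (ht : t ∈ Ioc a b) {k : ℝ → Matrix n m ℝ}
    (hk : ∀ s i j, k s i j = (Φ s a * C) i j + ∫ τ in a..min s t, (Φ s τ * R τ) i j)
    {s : ℝ} (hs : s ∈ Ioo a b) (hst : s ≠ t) (i : n) (j : m) :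
    HasDerivAt (fun σ => k σ i j) ((-(F s * k s) + if s < t then R s else 0) i j) s := by
  have ha : a ∈ Icc a b := left_mem_Icc.2 (hs.1.trans hs.2).le
  have hs' : s ∈ Icc a b := Ioo_subset_Icc_self hs
  have hg : ContinuousOn (fun τ => Φ a τ * R τ) (Icc a b) :=
    (continuousOn_matrix_of_hasDerivAt (hΦs a ha)).matrix_mul_matrix hR
  have hgij : ∀ i j, ContinuousOn (fun τ => (Φ a τ * R τ) i j) (Icc a b) := fun i j =>
    continuousOn_pi.1 (continuousOn_pi.1 hg i) j
  have hgint : ∀ i j, ∀ u ∈ Icc a b,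
      IntervalIntegrable (fun τ => (Φ a τ * R τ) i j) volume a u := fun i j u hu =>
    ((hgij i j).mono (by rw [uIcc_of_le hu.1]; exact Icc_subset_Icc_right hu.2)).intervalIntegrable
  set W : ℝ → Matrix n m ℝ := fun u => Matrix.of fun i j => ∫ τ in a..u, (Φ a τ * R τ) i j with hW
  have hmin : ∀ σ ∈ Icc a b, min σ t ∈ Icc a b := fun σ hσ =>
    ⟨le_min hσ.1 ht.1.le, (min_le_right _ _).trans ht.2⟩
  have hkW : ∀ σ ∈ Icc a b, k σ = Φ σ a * (C + W (min σ t)) := by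
    intro σ hσ
    ext i j
    rw [hk, Matrix.mul_add, Matrix.add_apply, Matrix.mul_apply (N := W _)]
    congr 1
    simp only [hW, Matrix.of_apply, ← intervalIntegral.integral_const_mul]
    rw [← intervalIntegral.integral_finsetSum fun l _ => (hgint l j _ (hmin σ hσ)).const_mul _]
    refine intervalIntegral.integral_congr fun τ hτ => ?_
    rw [uIcc_of_le (hmin σ hσ).1] at hτ
    have hτ' : τ ∈ Icc a b := ⟨hτ.1, hτ.2.trans (hmin σ hσ).2⟩
    rw [← evolutionFamily_mul hΦ0 hΦt hΦs hσ ha hτ', Matrix.mul_assoc, Matrix.mul_apply]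
  have hWd : ∀ i j, HasDerivAt (fun σ => (C + W (min σ t)) i j)
      ((if s < t then Φ a s * R s else 0) i j) s := by
    intro i j
    simp only [Matrix.add_apply]
    refine HasDerivAt.const_add _ ?_
    rcases lt_or_gt_of_ne hst with h | h
    · rw [if_pos h]
      have hnhds : Icc a b ∈ nhds s := Icc_mem_nhds hs.1 hs.2
      refine (intervalIntegral.integral_hasDerivAt_right (hgint i j s hs')
        ((hgij i j).stronglyMeasurableAtFilter_nhdsWithin measurableSet_Icc s |>.filter_mono
          (by rw [nhdsWithin_eq_nhds.2 hnhds]))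
        ((hgij i j).continuousAt hnhds)).congr_of_eventuallyEq ?_
      filter_upwards [Iio_mem_nhds h] with σ hσ
      simp only [hW, Matrix.of_apply, min_eq_left (mem_Iio.1 hσ).le]
    · rw [if_neg h.not_gt]
      refine (hasDerivAt_const s (W t i j)).congr_of_eventuallyEq ?_
      filter_upwards [Ioi_mem_nhds h] with σ hσ
      rw [min_eq_right (mem_Ioi.1 hσ).le]
  refine ((hasDerivAt_matrix_mul (hΦt a ha s hs') hWd i j).congr_of_eventuallyEq ?_).congr_deriv ?_
  · filter_upwards [Icc_mem_nhds hs.1 hs.2] with σ hσ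
    rw [hkW σ hσ]
  · rw [hkW s hs']
    split_ifs
    · rw [← Matrix.mul_assoc (Φ s a), evolutionFamily_mul hΦ0 hΦt hΦs hs' ha hs', hΦ0 s hs',
        Matrix.one_mul, Matrix.neg_mul, Matrix.mul_assoc]
    · rw [Matrix.mul_zero, Matrix.neg_mul, Matrix.mul_assoc]

end EvolutionFamily

/-- With `y_z(s) = K(s,t)z`, `χ(s) = Φ_A(t,s)ᵀz`,
`ρ(s) = Φ(t,s)ᵀz` and the adjoint state `q(s) = P(s)y_z(s) + 𝟙_{s<t}(χ(s) − ρ(s))`,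
the pair `(y_z, q)` solves the forward–backward system with source `𝟙_{s<t}BN⁻¹Bᵀχ`,
with `q(T) = 0` and `J₀ y_z(t₀) = χ(t₀) − q(t₀)`. -/
theorem stmt_9
    {n m : ℕ} {t₀ T : ℝ} (htT : t₀ < T)
    (A M : ℝ → Matrix (Fin n) (Fin n) ℝ)
    (B : ℝ → Matrix (Fin n) (Fin m) ℝ)
    (N : ℝ → Matrix (Fin m) (Fin m) ℝ)
    (hA : ContinuousOn A (Icc t₀ T)) (hM : ContinuousOn M (Icc t₀ T))
    (hB : ContinuousOn B (Icc t₀ T)) (hN : ContinuousOn N (Icc t₀ T))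
    (hMpsd : ∀ t ∈ Icc t₀ T, (M t).PosSemidef)
    (hNpd : ∀ t ∈ Icc t₀ T, (N t).PosDef)
    (P : ℝ → Matrix (Fin n) (Fin n) ℝ)
    (hP : ∀ t ∈ Icc t₀ T, ∀ i j, HasDerivAt (fun τ => P τ i j)
      ((P t * A t + (A t)ᵀ * P t + P t * B t * (N t)⁻¹ * (B t)ᵀ * P t - M t) i j) t)
    (hPT : P T = 0)
    (Φ : ℝ → ℝ → Matrix (Fin n) (Fin n) ℝ)
    (hΦ0 : ∀ s ∈ Icc t₀ T, Φ s s = 1)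
    (hΦt : ∀ s ∈ Icc t₀ T, ∀ t ∈ Icc t₀ T, ∀ i j,
      HasDerivAt (fun τ => Φ τ s i j)
        ((-((A t + B t * (N t)⁻¹ * (B t)ᵀ * P t) * Φ t s)) i j) t)
    (hΦs : ∀ t ∈ Icc t₀ T, ∀ s ∈ Icc t₀ T, ∀ i j,
      HasDerivAt (fun σ => Φ t σ i j)
        ((Φ t s * (A s + B s * (N s)⁻¹ * (B s)ᵀ * P s)) i j) s)
    (ΦA : ℝ → ℝ → Matrix (Fin n) (Fin n) ℝ)
    (hΦA0 : ∀ s ∈ Icc t₀ T, ΦA s s = 1)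
    (hΦAt : ∀ s ∈ Icc t₀ T, ∀ t ∈ Icc t₀ T, ∀ i j,
      HasDerivAt (fun τ => ΦA τ s i j) ((-(A t * ΦA t s)) i j) t)
    (hΦAs : ∀ t ∈ Icc t₀ T, ∀ s ∈ Icc t₀ T, ∀ i j,
      HasDerivAt (fun σ => ΦA t σ i j) ((ΦA t s * A s) i j) s)
    (J₀ : Matrix (Fin n) (Fin n) ℝ)
    (hJ₀ : J₀.PosSemidef) (hJP : IsUnit (J₀ + P t₀))
    (K : ℝ → ℝ → Matrix (Fin n) (Fin n) ℝ)
    (hK : ∀ s, ∀ t, ∀ i j,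
      K s t i j = (Φ s t₀ * (J₀ + P t₀)⁻¹ * (Φ t t₀)ᵀ) i j
        + ∫ τ in t₀..min s t, (Φ s τ * B τ * (N τ)⁻¹ * (B τ)ᵀ * (Φ t τ)ᵀ) i j)
    (t : ℝ) (ht : t ∈ Ioc t₀ T) (z : Fin n → ℝ)
    (y_z χ ρ q : ℝ → Fin n → ℝ)
    (hy_z : ∀ s, y_z s = K s t *ᵥ z)
    (hχ : ∀ s, χ s = (ΦA t s)ᵀ *ᵥ z)
    (hρ : ∀ s, ρ s = (Φ t s)ᵀ *ᵥ z)
    (hq : ∀ s, q s = P s *ᵥ y_z s + (if s < t then (1:ℝ) else 0) • (χ s - ρ s)) :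
    q T = 0 ∧
    J₀ *ᵥ y_z t₀ = χ t₀ - q t₀ ∧
    ∀ s ∈ Ioo t₀ t ∪ Ioo t T,
      HasDerivAt q ((A s)ᵀ *ᵥ q s - M s *ᵥ y_z s) s ∧
      HasDerivAt y_z
        ((if s < t then (B s * (N s)⁻¹ * (B s)ᵀ) *ᵥ χ s else 0)
          - A s *ᵥ y_z s - (B s * (N s)⁻¹ * (B s)ᵀ) *ᵥ q s) s := by
  set S : ℝ → Matrix (Fin n) (Fin n) ℝ := fun s => B s * (N s)⁻¹ * (B s)ᵀ with hS
  have hSsymm : ∀ s ∈ Icc t₀ T, (S s)ᵀ = S s := fun s hs => by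
    have hNT : (N s)ᵀ = N s := by simpa using (hNpd s hs).isHermitian.eq
    simp [hS, Matrix.transpose_nonsing_inv, hNT, Matrix.mul_assoc]
  have hScont : ContinuousOn S (Icc t₀ T) :=
    (hB.matrix_mul_matrix (hN.matrix_inv fun s hs => (hNpd s hs).det_pos.ne')).matrix_mul_matrix
      (continuous_id.matrix_transpose.comp_continuousOn hB)
  have hP' : ∀ s ∈ Icc t₀ T, ∀ i j, HasDerivAt (fun τ => P τ i j)
      ((P s * A s + (A s)ᵀ * P s + P s * S s * P s - M s) i j) s := by
    simpa only [hS, Matrix.mul_assoc] using hP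
  have hPsymm : ∀ s ∈ Icc t₀ T, (P s)ᵀ = P s := fun s hs => by
    refine (sub_eq_zero.1 (lyapunov_eq_zero (D := fun τ => P τ - (P τ)ᵀ) htT.le hΦ0 hΦt
      (fun σ hσ i j => ?_) (by simp [hPT]) hs)).symm
    have hMT : (M σ)ᵀ = M σ := by simpa using (hMpsd σ hσ).isHermitian.eq
    set Q := P σ * A σ + (A σ)ᵀ * P σ + P σ * S σ * P σ - M σ with hQ
    have hQeq : Q - Qᵀ =
        (P σ - (P σ)ᵀ) * (A σ + S σ * P σ) + (A σ + S σ * P σ)ᵀ * (P σ - (P σ)ᵀ) := by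
      simp only [hQ, Matrix.transpose_sub, Matrix.transpose_add, Matrix.transpose_mul,
        Matrix.transpose_transpose, hMT, hSsymm σ hσ]
      noncomm_ring
    exact ((hP' σ hσ i j).sub (hP' σ hσ j i)).congr_deriv (congrFun (congrFun hQeq i) j)
  have ht₀ : t₀ ∈ Icc t₀ T := left_mem_Icc.2 htT.le
  have ht' : t ∈ Icc t₀ T := Ioc_subset_Icc_self ht
  refine ⟨by simp [hq, hPT, ht.2.not_gt], ?_, ?_⟩
  · have hK₀ : K t₀ t = (J₀ + P t₀)⁻¹ * (Φ t t₀)ᵀ := by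
      ext i j
      rw [hK, min_eq_left ht.1.le, intervalIntegral.integral_same, add_zero, hΦ0 t₀ ht₀,
        Matrix.one_mul]
    have hy : (J₀ + P t₀) *ᵥ y_z t₀ = ρ t₀ := by
      rw [hy_z, hK₀, Matrix.mulVec_mulVec, Matrix.mul_nonsing_inv_cancel_left _ _
        ((Matrix.isUnit_iff_isUnit_det _).1 hJP), hρ]
    rw [hq, if_pos ht.1, one_smul, ← hy, Matrix.add_mulVec]
    abel
  intro s hs
  have hsI : s ∈ Ioo t₀ T := hs.elim (fun h => ⟨h.1, h.2.trans_le ht.2⟩)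
    (fun h => ⟨ht.1.trans h.1, h.2⟩)
  have hst : s ≠ t := hs.elim (fun h => h.2.ne) (fun h => h.1.ne')
  have hs' : s ∈ Icc t₀ T := Ioo_subset_Icc_self hsI
  have hΦtcont : ContinuousOn (fun τ => S τ * (Φ t τ)ᵀ) (Icc t₀ T) :=
    hScont.matrix_mul_matrix (continuous_id.matrix_transpose.comp_continuousOn
      (continuousOn_matrix_of_hasDerivAt (hΦs t ht')))
  have hKd := hasDerivAt_variation_of_constants hΦ0 hΦt hΦs hΦtcont
    ((J₀ + P t₀)⁻¹ * (Φ t t₀)ᵀ) ht (k := fun σ => K σ t)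
    (fun σ i j => by simpa only [hS, Matrix.mul_assoc] using hK σ t i j) hsI hst
  have hyd : HasDerivAt y_z
      (-((A s + S s * P s) *ᵥ y_z s) + if s < t then S s *ᵥ ρ s else 0) s := by
    have h := hasDerivAt_matrix_mulVec hKd (hasDerivAt_const s z)
    rw [funext hy_z]
    refine h.congr_deriv ?_
    rw [Matrix.mulVec_zero, add_zero, Matrix.add_mulVec, Matrix.neg_mulVec, ← Matrix.mulVec_mulVec,
      hρ]
    split_ifs <;> simp [Matrix.mulVec_mulVec, hS, Matrix.mul_assoc]
  have hχd : HasDerivAt χ ((A s)ᵀ *ᵥ χ s) s := by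
    have h := hasDerivAt_matrix_mulVec (X := fun σ => (ΦA t σ)ᵀ) (X' := (ΦA t s * A s)ᵀ)
      (fun i j => hΦAs t ht' s hs' j i) (hasDerivAt_const s z)
    rw [funext hχ]
    exact h.congr_deriv (by simp [Matrix.mulVec_mulVec])
  have hρd : HasDerivAt ρ ((A s + S s * P s)ᵀ *ᵥ ρ s) s := by
    have h := hasDerivAt_matrix_mulVec (X := fun σ => (Φ t σ)ᵀ)
      (X' := (Φ t s * (A s + S s * P s))ᵀ)
      (fun i j => hΦs t ht' s hs' j i) (hasDerivAt_const s z)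
    rw [funext hρ]
    exact h.congr_deriv (by simp [Matrix.mulVec_mulVec, -Matrix.transpose_add])
  have hPy := hasDerivAt_matrix_mulVec (hP' s hs') hyd
  rcases lt_or_gt_of_ne hst with h | h
  · have hqs : q s = P s *ᵥ y_z s + (χ s - ρ s) := by rw [hq, if_pos h, one_smul]
    rw [if_pos h] at hyd hPy ⊢
    constructor
    · refine ((hPy.add (hχd.sub hρd)).congr_of_eventuallyEq ?_).congr_deriv ?_
      · filter_upwards [Iio_mem_nhds h] with σ hσ
        simp [hq, if_pos (mem_Iio.1 hσ)]
      · simp only [hqs, Matrix.transpose_add, Matrix.transpose_mul, hSsymm s hs', hPsymm s hs',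
          Matrix.add_mulVec, Matrix.sub_mulVec, Matrix.mulVec_add, Matrix.mulVec_sub,
          Matrix.mulVec_neg, ← Matrix.mulVec_mulVec]
        abel
    · refine hyd.congr_deriv ?_
      change _ = S s *ᵥ χ s - A s *ᵥ y_z s - S s *ᵥ q s
      simp only [hqs, Matrix.add_mulVec, Matrix.mulVec_add, Matrix.mulVec_sub,
        ← Matrix.mulVec_mulVec]
      abel
  · have hqs : q s = P s *ᵥ y_z s := by rw [hq, if_neg h.not_gt, zero_smul, add_zero]
    rw [if_neg h.not_gt] at hyd hPy ⊢
    constructor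
    · refine (hPy.congr_of_eventuallyEq ?_).congr_deriv ?_
      · filter_upwards [Ioi_mem_nhds h] with σ hσ
        simp [hq, if_neg (mem_Ioi.1 hσ).not_gt]
      · simp only [hqs, Matrix.add_mulVec, Matrix.sub_mulVec, Matrix.mulVec_add,
          Matrix.mulVec_neg, Matrix.mulVec_zero, ← Matrix.mulVec_mulVec]
        abel
    · refine hyd.congr_deriv ?_
      change _ = 0 - A s *ᵥ y_z s - S s *ᵥ q s
      simp only [hqs, Matrix.add_mulVec, ← Matrix.mulVec_mulVec]
      abel
end
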